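/- Let γ, σ > 0 and let p : (0,∞) → [0,1] be measurable with √t · p(t) → 1/√(2πσ²) as t → ∞. Then for every real C > log(√(2π)·γ/σ) there exist K > e and K' > 0 such that the function f defined by f(t) = (1/2)log t − log log t + C for t ≥ K and f(t) = K' for 0 ≤ t < K satisfies the strict supersolution inequality f(t) > ∫₀ᵗ γ p(t−s) exp(−f(s)) ds for all t ≥ 0. -/

import Mathlib

open Real

open MeasureTheory Set Filter

theorem hasDerivAt_arcsin_two_mul_div_sub_one {t s : ℝ} (hs : s ∈ Ioo 0 t) :
    HasDerivAt (fun s => arcsin (2 * s / t - 1)) (√(s * (t - s)))⁻¹ s := by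
  obtain ⟨h0, h1⟩ := hs
  have ht : 0 < t := h0.trans h1
  have hlt : 2 * s / t < 2 := by rw [div_lt_iff₀ ht]; linarith
  have hpos : 0 < 2 * s / t := by positivity
  have hinner : HasDerivAt (fun s => 2 * s / t - 1) (2 / t) s := by
    simpa using (((hasDerivAt_id s).const_mul 2).div_const t).sub_const 1
  have h := (hasDerivAt_arcsin (x := 2 * s / t - 1) (by linarith) (by linarith)).comp s hinner
  refine h.congr_deriv ?_
  have hsq : 1 - (2 * s / t - 1) ^ 2 = (2 / t) ^ 2 * (s * (t - s)) := by field_simp; ring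
  rw [hsq, sqrt_mul (by positivity), sqrt_sq (by positivity)]
  have : 0 < √(s * (t - s)) := sqrt_pos.2 (mul_pos h0 (by linarith))
  field_simp

theorem continuous_arcsin_two_mul_div_sub_one (t : ℝ) :
    Continuous fun s => arcsin (2 * s / t - 1) :=
  continuous_arcsin.comp (by fun_prop)

theorem intervalIntegrable_inv_sqrt_mul_sub {t : ℝ} (ht : 0 < t) :
    IntervalIntegrable (fun s => (√(s * (t - s)))⁻¹) volume 0 t := by
  refine intervalIntegral.intervalIntegrable_deriv_of_nonneg
    (continuous_arcsin_two_mul_div_sub_one t).continuousOn ?_ ?_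
  · intro s hs
    rw [min_eq_left ht.le, max_eq_right ht.le] at hs
    exact hasDerivAt_arcsin_two_mul_div_sub_one hs
  · intro s _
    positivity

theorem integral_inv_sqrt_mul_sub {t : ℝ} (ht : 0 < t) :
    ∫ s in (0 : ℝ)..t, (√(s * (t - s)))⁻¹ = π := by
  rw [intervalIntegral.integral_eq_sub_of_hasDerivAt_of_le ht.le
    (continuous_arcsin_two_mul_div_sub_one t).continuousOn
    (fun s hs => hasDerivAt_arcsin_two_mul_div_sub_one hs)
    (intervalIntegrable_inv_sqrt_mul_sub ht)]
  have h1 : 2 * t / t - 1 = 1 := by field_simp; norm_num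
  have h0 : 2 * (0 : ℝ) / t - 1 = -1 := by simp
  simp only [h1, h0, arcsin_one, arcsin_neg_one]
  ring

theorem intervalIntegral_mono_of_nonneg_Ioo {f g : ℝ → ℝ} {t : ℝ} (ht : 0 ≤ t)
    (hf : ∀ s ∈ Ioo 0 t, 0 ≤ f s) (hg : IntervalIntegrable g volume 0 t)
    (hfg : ∀ s ∈ Ioo 0 t, f s ≤ g s) :
    ∫ s in (0 : ℝ)..t, f s ≤ ∫ s in (0 : ℝ)..t, g s := by
  rw [intervalIntegral.integral_of_le ht, intervalIntegral.integral_of_le ht,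
    integral_Ioc_eq_integral_Ioo, integral_Ioc_eq_integral_Ioo]
  rw [intervalIntegrable_iff_integrableOn_Ioo_of_le ht] at hg
  exact integral_mono_of_nonneg ((ae_restrict_iff' measurableSet_Ioo).2 (.of_forall hf)) hg
    ((ae_restrict_iff' measurableSet_Ioo).2 (.of_forall hfg))

theorem intervalIntegrable_indicator_one {t : ℝ} {S : Set ℝ} (hS : MeasurableSet S) :
    IntervalIntegrable (S.indicator fun _ => (1 : ℝ)) volume 0 t := by
  rw [intervalIntegrable_iff]
  exact (integrableOn_const (by simp)).indicator hS

theorem integral_indicator_one_le {t a b : ℝ} (ht : 0 ≤ t) (hab : a ≤ b) {S : Set ℝ}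
    (hS : MeasurableSet S) (hsub : Ioc 0 t ∩ S ⊆ Icc a b) :
    ∫ s in (0 : ℝ)..t, S.indicator (fun _ => (1 : ℝ)) s ≤ b - a := by
  rw [intervalIntegral.integral_of_le ht, setIntegral_indicator hS, setIntegral_const,
    smul_eq_mul, mul_one, ← Real.volume_real_Icc_of_le hab]
  exact measureReal_mono hsub (by simp)

theorem exp_neg_half_log_sub_log_log_add {s : ℝ} (C : ℝ) (hs : 1 < s) :
    exp (-((1 / 2) * log s - log (log s) + C)) = exp (-C) * log s * (√s)⁻¹ := by
  have hs0 : 0 < s := by linarith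
  have hsqrt : √s = exp ((1 / 2) * log s) := by
    rw [sqrt_eq_rpow, rpow_def_of_pos hs0, mul_comm]
  rw [hsqrt, ← Real.exp_neg]
  nth_rewrite 3 [← exp_log (log_pos hs)]
  rw [← Real.exp_add, ← Real.exp_add]
  ring_nf

theorem log_le_two_mul_sqrt {s : ℝ} (hs : 0 < s) : log s ≤ 2 * √s := by
  have h := log_le_sub_one_of_pos (sqrt_pos.2 hs)
  rw [log_sqrt hs.le] at h
  linarith

theorem eventually_mul_log_add_lt {θ : ℝ} (hθ : θ < 1 / 2) (C D : ℝ) :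
    ∀ᶠ t in atTop, θ * log t + D < (1 / 2) * log t - log (log t) + C := by
  have hlim : ∀ᶠ L : ℝ in atTop, θ * L + D < (1 / 2) * L - log L + C := by
    have hδ : 0 < (1 / 2 - θ) / 2 := by linarith
    filter_upwards [isLittleO_log_id_atTop.bound hδ, eventually_gt_atTop 0,
      eventually_gt_atTop ((D - C) / ((1 / 2 - θ) / 2))] with L h1 h2 h3
    rw [div_lt_iff₀ hδ] at h3
    simp only [id, norm_eq_abs, abs_of_pos h2] at h1
    have := (le_abs_self _).trans h1
    linarith
  exact tendsto_log_atTop.eventually hlim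

/-- Existence of a strict supersolution `f(t) = (1/2)log t − log log t + C` (for `t ≥ K`,
and `K'` before `K`) to the functional equation `f(t) = ∫₀ᵗ γ p(t−s) e^{−f(s)} ds`,
for any `C > log(√(2π)γ/σ)`, given the local CLT asymptotics `p(t) ∼ (2πσ²t)^{−1/2}`. -/
theorem strict_supersolution_exists
    (γ σ : ℝ) (hγ : 0 < γ) (hσ : 0 < σ)
    (p : ℝ → ℝ) (hp_meas : Measurable p)
    (hp_range : ∀ t > (0 : ℝ), p t ∈ Set.Icc (0 : ℝ) 1)
    (hp_clt : Filter.Tendsto (fun t => Real.sqrt t * p t) Filter.atTop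
      (nhds (1 / Real.sqrt (2 * π * σ ^ 2))))
    (C : ℝ) (hC : C > Real.log (Real.sqrt (2 * π) * γ / σ)) :
    ∃ K > Real.exp 1, ∃ K' > (0 : ℝ),
      ∀ t ≥ (0 : ℝ),
        (if K ≤ t then (1 / 2) * Real.log t - Real.log (Real.log t) + C else K')
          > ∫ s in (0 : ℝ)..t, γ * p (t - s) *
              Real.exp (-(if K ≤ s then (1 / 2) * Real.log s - Real.log (Real.log s) + C
                else K')) := by
  have hcrit : 1 / √(2 * π * σ ^ 2) < 1 / (2 * (γ * exp (-C) * π)) := by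
    have hr : 0 < √(2 * π) := sqrt_pos.2 (by positivity)
    have hrr : √(2 * π) * √(2 * π) = 2 * π := mul_self_sqrt (by positivity)
    have h1 : √(2 * π) * γ / σ < exp C := (log_lt_iff_lt_exp (by positivity)).1 hC
    rw [div_lt_iff₀ hσ] at h1
    rw [sqrt_mul (by positivity), sqrt_sq hσ.le]
    apply one_div_lt_one_div_of_lt (by positivity)
    rw [Real.exp_neg]
    calc 2 * (γ * (exp C)⁻¹ * π) = √(2 * π) * (√(2 * π) * γ) * (exp C)⁻¹ := by
          linear_combination -(γ * (exp C)⁻¹) * hrr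
      _ < √(2 * π) * (exp C * σ) * (exp C)⁻¹ := by gcongr
      _ = √(2 * π) * σ := by field_simp
  obtain ⟨b, hab, hb⟩ := exists_between hcrit
  have hb0 : 0 < b := lt_of_le_of_lt (by positivity) hab
  set c := γ * exp (-C) with hc
  have hc0 : 0 < c := by positivity
  have hθ : c * b * π < 1 / 2 := by
    rw [lt_div_iff₀ (by positivity)] at hb
    linarith
  obtain ⟨T, hT⟩ := eventually_atTop.1 (hp_clt.eventually_le_const hab)
  set T₀ := max T 1
  have hT₀ : 0 < T₀ := lt_of_lt_of_le one_pos (le_max_right _ _)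
  have hpT : ∀ u ≥ T₀, p u ≤ b * (√u)⁻¹ := fun u hu => by
    have hu0 : 0 < √u := sqrt_pos.2 (hT₀.trans_le hu)
    rw [← div_eq_mul_inv, le_div_iff₀ hu0, mul_comm]
    exact hT u ((le_max_left _ _).trans hu)
  obtain ⟨K₀, hK₀⟩ := eventually_atTop.1 (eventually_mul_log_add_lt hθ C (2 * c * T₀ + 1))
  obtain ⟨K, hKK₀, hKe⟩ : ∃ K, K₀ ≤ K ∧ exp 1 < K :=
    ⟨max K₀ (exp 1 + 1), le_max_left _ _, (lt_add_one _).trans_le (le_max_right _ _)⟩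
  have hK1 : 1 < K := (one_lt_exp_iff.2 one_pos).trans hKe
  have hK0 : 0 < K := one_pos.trans hK1
  have hγK : 0 < γ * K := by positivity
  set K' := γ * K with hK'
  have hsmall : γ * exp (-K') * K < 1 := by
    have h1 : K' < exp K' := (lt_add_one _).trans_le (add_one_le_exp K')
    calc γ * exp (-K') * K = K' * exp (-K') := by rw [hK']; ring
      _ < exp K' * exp (-K') := by gcongr
      _ = 1 := by rw [← Real.exp_add]; simp
  have hle : γ * exp (-K') * K < K' := by
    have : exp (-K') < 1 := exp_lt_one_iff.2 (by linarith)
    nlinarith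
  refine ⟨K, hKe, K', hγK, fun t ht => ?_⟩
  have hp : ∀ s ∈ Ioo 0 t, 0 ≤ p (t - s) ∧ p (t - s) ≤ 1 := fun s hs =>
    hp_range _ (sub_pos.2 hs.2)
  have hnonneg : ∀ s ∈ Ioo 0 t, 0 ≤ γ * p (t - s) *
      exp (-(if K ≤ s then (1 / 2) * log s - log (log s) + C else K')) := fun s hs =>
    mul_nonneg (mul_nonneg hγ.le (hp s hs).1) (exp_pos _).le
  have hbefore : ∀ s ∈ Ioo 0 t, γ * p (t - s) * exp (-K') ≤ γ * exp (-K') := fun s hs => by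
    have := mul_le_mul_of_nonneg_left (hp s hs).2 (show 0 ≤ γ * exp (-K') by positivity)
    linarith
  split_ifs with hKt
  · have ht0 : 0 < t := hK0.trans_le hKt
    have hlogt : 0 ≤ log t := log_nonneg (hK1.le.trans hKt)
    have hi1 := (intervalIntegrable_indicator_one (t := t)
      (measurableSet_Iio (a := K))).const_mul (γ * exp (-K'))
    have hi2 := (intervalIntegrable_inv_sqrt_mul_sub ht0).const_mul (c * b * log t)
    have hi3 := (intervalIntegrable_indicator_one (t := t)
      (measurableSet_Ioi (a := t - T₀))).const_mul (2 * c)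
    have hbound := intervalIntegral_mono_of_nonneg_Ioo ht hnonneg ((hi1.add hi2).add hi3) ?_
    · have hI1 := integral_indicator_one_le (t := t) ht hK0.le (measurableSet_Iio (a := K))
        (fun s hs => ⟨hs.1.1.le, hs.2.le⟩)
      have hI3 := integral_indicator_one_le (t := t) ht (sub_le_self t hT₀.le)
        (measurableSet_Ioi (a := t - T₀)) (fun s hs => ⟨le_of_lt hs.2, hs.1.2⟩)
      rw [intervalIntegral.integral_add (hi1.add hi2) hi3,
        intervalIntegral.integral_add hi1 hi2, intervalIntegral.integral_const_mul,
        intervalIntegral.integral_const_mul, intervalIntegral.integral_const_mul,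
        integral_inv_sqrt_mul_sub ht0] at hbound
      have h1 := mul_le_mul_of_nonneg_left hI1 (show 0 ≤ γ * exp (-K') by positivity)
      have h3 := mul_le_mul_of_nonneg_left hI3 (show 0 ≤ 2 * c by positivity)
      have := hK₀ t (hKK₀.trans hKt)
      linarith
    · intro s hs
      have hind : ∀ S : Set ℝ, 0 ≤ S.indicator (fun _ => (1 : ℝ)) s := fun S =>
        indicator_nonneg (fun _ _ => zero_le_one) s
      have hn1 := mul_nonneg (show 0 ≤ γ * exp (-K') by positivity) (hind (Iio K))
      have hn2 : 0 ≤ c * b * log t * (√(s * (t - s)))⁻¹ := by positivity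
      have hn3 := mul_nonneg (show 0 ≤ 2 * c by positivity) (hind (Ioi (t - T₀)))
      split_ifs with hKs
      · have hs1 : 1 < s := hK1.trans_le hKs
        have hlogs : 0 < log s := log_pos hs1
        have hsq : 0 < √s := sqrt_pos.2 hs.1
        rw [exp_neg_half_log_sub_log_log_add C hs1]
        by_cases hsT : t - T₀ < s
        · have hle : log s * (√s)⁻¹ ≤ 2 := by
            rw [← div_eq_mul_inv, div_le_iff₀ hsq]
            exact log_le_two_mul_sqrt hs.1
          have hmain : γ * p (t - s) * (exp (-C) * log s * (√s)⁻¹) ≤ 2 * c := by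
            calc γ * p (t - s) * (exp (-C) * log s * (√s)⁻¹)
                = c * (p (t - s) * (log s * (√s)⁻¹)) := by rw [hc]; ring
              _ ≤ c * (1 * 2) := by
                have := hp s hs
                gcongr
                exact this.2
              _ = 2 * c := by ring
          rw [indicator_of_mem (show s ∈ Ioi (t - T₀) from hsT)] at hn3 ⊢
          linarith
        · have hmain : γ * p (t - s) * (exp (-C) * log s * (√s)⁻¹)
              ≤ c * b * log t * (√(s * (t - s)))⁻¹ := by
            calc γ * p (t - s) * (exp (-C) * log s * (√s)⁻¹)
                = c * (p (t - s) * (log s * (√s)⁻¹)) := by rw [hc]; ring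
              _ ≤ c * (b * (√(t - s))⁻¹ * (log t * (√s)⁻¹)) := by
                gcongr
                · exact hpT _ (by linarith)
                · exact hs.2.le
              _ = c * b * log t * (√(s * (t - s)))⁻¹ := by
                rw [sqrt_mul hs.1.le, mul_inv]; ring
          linarith
      · rw [indicator_of_mem (show s ∈ Iio K from not_le.1 hKs)] at hn1 ⊢
        have := hbefore s hs
        linarith
  · have htK : t < K := not_le.1 hKt
    have hbound := intervalIntegral_mono_of_nonneg_Ioo ht hnonneg
      (intervalIntegrable_const (c := γ * exp (-K'))) fun s hs => by
        rw [if_neg (not_le.2 (hs.2.trans htK))]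
        exact hbefore s hs
    rw [intervalIntegral.integral_const, smul_eq_mul, sub_zero] at hbound
    have := mul_le_mul_of_nonneg_left htK.le (show 0 ≤ γ * exp (-K') by positivity)
    linarith
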